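/- Let λ/μ and α/β be basic connected skew diagrams with μ ≠ (1) ≠ β, where μ is a single row (length(μ) = 1) and β is a single column (β_1 = 1), both λ and α have at least 4 distinct part sizes, and s_{λ/μ} = s_{α/β}. Then λ = α = (l, l−1, …, 2, 1) is a staircase partition and α/β is the conjugate of λ/μ, i.e. β = μ' and α/β = (λ/μ)'. -/

import Mathlib

open YoungDiagram
open scoped Classical

namespace LRSkew

/-- The cells of the skew diagram `lam/mu`. -/
def skewCells (lam mu : YoungDiagram) : Finset (ℕ × ℕ) := lam.cells \ mu.cells

/-- A semistandard filling of the skew shape `lam/mu`: entries are positive exactly on the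
cells of the shape, rows are weakly increasing and columns are strictly increasing. -/
def IsSSYT (lam mu : YoungDiagram) (T : ℕ × ℕ → ℕ) : Prop :=
  (∀ p, p ∈ skewCells lam mu ↔ T p ≠ 0) ∧
  (∀ i j1 j2, (i, j1) ∈ skewCells lam mu → (i, j2) ∈ skewCells lam mu → j1 ≤ j2 →
    T (i, j1) ≤ T (i, j2)) ∧
  (∀ i1 i2 j, (i1, j) ∈ skewCells lam mu → (i2, j) ∈ skewCells lam mu → i1 < i2 →
    T (i1, j) < T (i2, j))

/-- The number of entries equal to `k` among the cells read (in the reverse reading word: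
right to left along rows, top row first) up to position `(i,j)`. -/
def prefixCount (lam mu : YoungDiagram) (T : ℕ × ℕ → ℕ) (i j k : ℕ) : ℕ :=
  ((skewCells lam mu).filter fun p => (p.1 < i ∨ (p.1 = i ∧ j ≤ p.2)) ∧ T p = k).card

/-- The reverse reading word of the filling is a lattice word. -/
def IsLattice (lam mu : YoungDiagram) (T : ℕ × ℕ → ℕ) : Prop :=
  ∀ i j k, prefixCount lam mu T i j (k + 2) ≤ prefixCount lam mu T i j (k + 1)

/-- The number of entries of the filling equal to `k`. -/
def content (lam mu : YoungDiagram) (T : ℕ × ℕ → ℕ) (k : ℕ) : ℕ :=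
  ((skewCells lam mu).filter fun p => T p = k).card

/-- A Littlewood–Richardson tableau of shape `lam/mu` and content `nu`. -/
def IsLR (lam mu nu : YoungDiagram) (T : ℕ × ℕ → ℕ) : Prop :=
  IsSSYT lam mu T ∧ IsLattice lam mu T ∧ ∀ i, content lam mu T (i + 1) = nu.rowLen i

/-- The Littlewood–Richardson coefficient `c(lam; mu, nu)`. -/
noncomputable def lrCoeff (lam mu nu : YoungDiagram) : ℕ :=
  if mu ≤ lam then {T : ℕ × ℕ → ℕ | IsLR lam mu nu T}.ncard else 0

/-- Equality of the skew Schur functions `s_{lam/mu} = s_{alp/bet}`, expressed through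
their expansions into Schur functions. -/
def SchurEq (lam mu alp bet : YoungDiagram) : Prop :=
  ∀ nu : YoungDiagram, lrCoeff lam mu nu = lrCoeff alp bet nu

/-- The rectangular Young diagram `(k^l)` with `l` rows of length `k`. -/
def rect (k l : ℕ) : YoungDiagram :=
  ⟨Finset.range l ×ˢ Finset.range k, by
    intro a b hba ha
    simp only [Finset.coe_product, Set.mem_prod, Finset.mem_coe, Finset.mem_range] at ha ⊢
    exact ⟨lt_of_le_of_lt hba.1 ha.1, lt_of_le_of_lt hba.2 ha.2⟩⟩

/-- The complement of `nu` in the rectangle `(k^l)`, rotated by 180 degrees so that it is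
again a partition: its parts are `(k - nu_l, …, k - nu_1)`. -/
def complRect (k l : ℕ) (nu : YoungDiagram) : YoungDiagram :=
  ⟨(rect k l).cells.filter fun p => (l - 1 - p.1, k - 1 - p.2) ∉ nu, by
    intro a b hba ha
    simp only [Finset.coe_filter, Set.mem_setOf_eq, mem_cells] at ha ⊢
    refine ⟨(rect k l).isLowerSet hba ha.1, fun hmem => ha.2 ?_⟩
    exact nu.isLowerSet
      (Prod.mk_le_mk.mpr ⟨Nat.sub_le_sub_left hba.1 _, Nat.sub_le_sub_left hba.2 _⟩) hmem⟩

/-- The staircase partition `(n, n-1, …, 2, 1)`. -/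
def staircase (n : ℕ) : YoungDiagram :=
  ⟨(Finset.range n ×ˢ Finset.range n).filter fun p => p.1 + p.2 < n, by
    intro a b hba ha
    simp only [Finset.coe_filter, Set.mem_setOf_eq, Finset.mem_product, Finset.mem_range] at ha ⊢
    exact ⟨⟨lt_of_le_of_lt hba.1 ha.1.1, lt_of_le_of_lt hba.2 ha.1.2⟩,
      lt_of_le_of_lt (Nat.add_le_add hba.1 hba.2) ha.2⟩⟩

/-- A basic skew diagram: no empty rows and no empty columns. -/
def IsBasic (lam mu : YoungDiagram) : Prop :=
  (∀ i, i < lam.colLen 0 → mu.rowLen i < lam.rowLen i) ∧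
  (∀ j, j < lam.rowLen 0 → mu.colLen j < lam.colLen j)

/-- A (basic) skew diagram is connected iff consecutive rows share a column. -/
def IsConnectedSkew (lam mu : YoungDiagram) : Prop :=
  ∀ i, i + 1 < lam.colLen 0 → mu.rowLen i < lam.rowLen (i + 1)

/-- The number of distinct (positive) part sizes of a partition. -/
def dp (lam : YoungDiagram) : ℕ :=
  ((Finset.range (lam.colLen 0)).image fun i => lam.rowLen i).card

/-- A partition is a rectangle: all its parts are equal. -/
def IsRect (mu : YoungDiagram) : Prop :=
  ∀ i, i < mu.colLen 0 → mu.rowLen i = mu.rowLen 0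

/-- Cells of a skew diagram in the same connected component: the reflexive–transitive
closure of sharing a row or a column. -/
def SameComp (s : Finset (ℕ × ℕ)) : ℕ × ℕ → ℕ × ℕ → Prop :=
  Relation.ReflTransGen fun a b => a ∈ s ∧ b ∈ s ∧ (a.1 = b.1 ∨ a.2 = b.2)

/-- Two finite sets of boxes agree up to translation or 180°-rotation of each connected
component independently. -/
def UpToTransRot (s t : Finset (ℕ × ℕ)) : Prop :=
  ∃ f : ℕ × ℕ → ℕ × ℕ, Set.BijOn f ↑s ↑t ∧
    ∀ p ∈ s, ∀ q ∈ s, SameComp s p q →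
      (((f q).1 : ℤ) - (f p).1 = (q.1 : ℤ) - p.1 ∧ ((f q).2 : ℤ) - (f p).2 = (q.2 : ℤ) - p.2) ∨
      (((f q).1 : ℤ) - (f p).1 = (p.1 : ℤ) - q.1 ∧ ((f q).2 : ℤ) - (f p).2 = (p.2 : ℤ) - q.2)


/-- `lam` with its first row removed (and shifted up). -/
def minus (lam : YoungDiagram) : YoungDiagram :=
  ⟨lam.cells.filter fun p => (p.1 + 1, p.2) ∈ lam, by
    intro a b hba ha
    simp only [Finset.coe_filter, Set.mem_setOf_eq, mem_cells] at ha ⊢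
    refine ⟨lam.isLowerSet hba ha.1, lam.isLowerSet (Prod.mk_le_mk.mpr ⟨?_, hba.2⟩) ha.2⟩
    exact Nat.add_le_add_right hba.1 1⟩

lemma mem_minus (lam : YoungDiagram) (i j : ℕ) : (i, j) ∈ minus lam ↔ (i + 1, j) ∈ lam := by
  rw [← mem_cells]
  simp only [minus, Finset.mem_filter, mem_cells, and_iff_right_iff_imp]
  intro h
  exact lam.up_left_mem (Nat.le_succ i) le_rfl h

lemma minus_le (lam : YoungDiagram) : minus lam ≤ lam := by
  intro p hp
  obtain ⟨i, j⟩ := p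
  exact lam.up_left_mem (Nat.le_succ i) le_rfl ((mem_minus lam i j).1 hp)

lemma card_minus (lam : YoungDiagram) : (minus lam).card + lam.rowLen 0 = lam.card := by
  have h1 : lam.cells = (minus lam).cells.image (fun p => (p.1 + 1, p.2)) ∪ lam.row 0 := by
    ext ⟨i, j⟩
    simp only [Finset.mem_union, Finset.mem_image, mem_cells, mem_row_iff, Prod.exists,
      Prod.mk.injEq]
    constructor
    · intro h
      rcases i with _ | i
      · right; exact ⟨h, rfl⟩
      · left; exact ⟨i, j, (mem_minus _ _ _).2 h, rfl, rfl⟩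
    · rintro (⟨a, b, h, rfl, rfl⟩ | h)
      · exact (mem_minus _ _ _).1 h
      · exact h.1
  have h2 : Disjoint ((minus lam).cells.image (fun p => (p.1 + 1, p.2))) (lam.row 0) := by
    rw [Finset.disjoint_left]
    rintro ⟨i, j⟩ h h'
    simp only [Finset.mem_image, mem_row_iff, Prod.exists, Prod.mk.injEq] at h h'
    obtain ⟨a, b, -, h3, -⟩ := h
    omega
  have h3 := congrArg Finset.card h1
  rw [Finset.card_union_of_disjoint h2, Finset.card_image_of_injective, ← rowLen_eq_card] at h3
  · exact h3.symm
  · rintro ⟨a, b⟩ ⟨c, d⟩ h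
    simp only [Prod.mk.injEq, add_left_inj] at h
    simp [h.1, h.2]

/-- `lam/nu` is a horizontal strip of size `m`. -/
def HS (lam : YoungDiagram) (m : ℕ) (nu : YoungDiagram) : Prop :=
  minus lam ≤ nu ∧ nu ≤ lam ∧ nu.card + m = lam.card

lemma interp (A : YoungDiagram) (n : ℕ) (hA : A.card ≤ n) :
    ∀ d (B : YoungDiagram), A ≤ B → B.card = n + d → ∃ nu, A ≤ nu ∧ nu ≤ B ∧ nu.card = n := by
  intro d
  induction d with
  | zero => intro B hAB hB; exact ⟨B, hAB, le_rfl, hB⟩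
  | succ d ih =>
    intro B hAB hB
    have hne : (B.cells \ A.cells).Nonempty := by
      rw [Finset.sdiff_nonempty]
      intro h
      have := Finset.card_le_card h
      change B.card ≤ A.card at this
      omega
    obtain ⟨c, hc⟩ := (B.cells \ A.cells).exists_maximal hne
    have hcB : c ∈ B.cells := (Finset.mem_sdiff.1 hc.1).1
    have hcA : c ∉ A.cells := (Finset.mem_sdiff.1 hc.1).2
    let C : YoungDiagram := ⟨B.cells.erase c, by
      intro a b hba ha
      simp only [Finset.coe_erase, Set.mem_diff, Finset.mem_coe, Set.mem_singleton_iff] at ha ⊢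
      refine ⟨B.isLowerSet hba ha.1, ?_⟩
      rintro rfl
      have haA : a ∉ A.cells := fun h => hcA (A.isLowerSet hba h)
      exact ha.2 (le_antisymm (hc.2 (Finset.mem_sdiff.2 ⟨ha.1, haA⟩) hba) hba)⟩
    have hC : C.card = n + d := by
      change (B.cells.erase c).card = _
      rw [Finset.card_erase_of_mem hcB]
      change B.card - 1 = _
      omega
    have hAC : A ≤ C := by
      intro p hp
      exact Finset.mem_erase.2 ⟨fun h => hcA (h ▸ hp), hAB hp⟩
    obtain ⟨nu, h1, h2, h3⟩ := ih C hAC hC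
    exact ⟨nu, h1, h2.trans (fun p hp => (Finset.mem_erase.1 hp).2), h3⟩

lemma HS_interp (lam A B : YoungDiagram) (m : ℕ) (hA : minus lam ≤ A) (hAB : A ≤ B)
    (hB : B ≤ lam) (h1 : A.card + m ≤ lam.card) (h2 : lam.card ≤ B.card + m) :
    ∃ nu, HS lam m nu ∧ A ≤ nu ∧ nu ≤ B := by
  obtain ⟨nu, h3, h4, h5⟩ := interp A (lam.card - m) (by omega) (B.card - (lam.card - m)) B hAB
    (by omega)
  exact ⟨nu, ⟨hA.trans h3, h4.trans hB, by omega⟩, h3, h4⟩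

lemma HS_exists_mem (lam : YoungDiagram) (m i j : ℕ) (hq : (i, j) ∈ lam)
    (hm : m ≤ lam.rowLen 0)
    (h : j + 1 + m ≤ lam.rowLen (i + 1) + lam.rowLen 0) : ∃ nu, HS lam m nu ∧ (i, j) ∈ nu := by
  have hc := card_minus lam
  have hle : minus lam ⊔ rect (j + 1) (i + 1) ≤ lam := by
    refine sup_le (minus_le lam) ?_
    rintro ⟨a, b⟩ hab
    have hab' : (a, b) ∈ Finset.range (i + 1) ×ˢ Finset.range (j + 1) := hab
    simp only [Finset.mem_product, Finset.mem_range] at hab'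
    exact lam.up_left_mem (by omega) (by omega) hq
  have hcard : (minus lam ⊔ rect (j + 1) (i + 1)).card + m ≤ lam.card := by
    have : (minus lam ⊔ rect (j + 1) (i + 1)).cells ⊆
        (minus lam).cells ∪ (Finset.Ico (lam.rowLen (i + 1)) (j + 1)).image (fun b => (i, b)) := by
      rintro ⟨a, b⟩ hab
      rw [cells_sup, Finset.mem_union] at hab
      rw [Finset.mem_union]
      rcases hab with hab | hab
      · exact Or.inl hab
      · have hab' : (a, b) ∈ Finset.range (i + 1) ×ˢ Finset.range (j + 1) := hab
        simp only [Finset.mem_product, Finset.mem_range] at hab'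
        by_cases hmem : (a + 1, b) ∈ lam
        · left; exact (mem_minus _ _ _).2 hmem
        · right
          have hai : a = i := by
            by_contra hne
            exact hmem (lam.up_left_mem (by omega) (by omega) hq)
          subst hai
          rw [mem_iff_lt_rowLen] at hmem
          simp only [Finset.mem_image, Finset.mem_Ico, Prod.mk.injEq, true_and, exists_eq_right]
          omega
    have h1 := Finset.card_le_card this
    have h2 := Finset.card_union_le (minus lam).cells
      ((Finset.Ico (lam.rowLen (i + 1)) (j + 1)).image (fun b => (i, b)))
    have h3 : ((Finset.Ico (lam.rowLen (i + 1)) (j + 1)).image (fun b => (i, b))).card ≤ _ :=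
      Finset.card_image_le
    rw [Nat.card_Ico] at h3
    change (minus lam ⊔ rect (j + 1) (i + 1)).card ≤ _ at h1
    change _ ≤ (minus lam).card + _ at h2
    omega
  obtain ⟨nu, h1, h2, -⟩ := HS_interp lam _ lam m le_sup_left hle le_rfl hcard (by omega)
  refine ⟨nu, h1, h2 ?_⟩
  have : (i, j) ∈ (minus lam).cells ∪ (Finset.range (i + 1) ×ˢ Finset.range (j + 1)) := by
    simp
  exact this

lemma HS_exists_not_mem (lam : YoungDiagram) (m i j : ℕ) (hq : lam.rowLen (i + 1) ≤ j)
    (hm : m ≤ lam.rowLen 0)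
    (h : lam.rowLen i ≤ j + m) : ∃ nu, HS lam m nu ∧ (i, j) ∉ nu := by
  have hc := card_minus lam
  let B : YoungDiagram := ⟨lam.cells.filter (fun p => ¬ ((i, j) ≤ p)), by
    intro a b hba ha
    simp only [Finset.coe_filter, Set.mem_setOf_eq, mem_cells] at ha ⊢
    exact ⟨lam.isLowerSet hba ha.1, fun h => ha.2 (h.trans hba)⟩⟩
  have hB : B ≤ lam := fun p hp => (Finset.mem_filter.1 hp).1
  have hAB : minus lam ≤ B := by
    rintro ⟨a, b⟩ hab
    refine Finset.mem_filter.2 ⟨minus_le lam hab, ?_⟩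
    intro hle
    have h1 := (mem_minus _ _ _).1 hab
    have h2 : (i + 1, j) ∈ lam :=
      lam.up_left_mem (Nat.add_le_add_right hle.1 1) hle.2 h1
    rw [mem_iff_lt_rowLen] at h2
    omega
  have hcard : lam.card ≤ B.card + m := by
    have : lam.cells ⊆ B.cells ∪ (Finset.Ico j (lam.rowLen i)).image (fun b => (i, b)) := by
      rintro ⟨a, b⟩ hab
      rw [Finset.mem_union]
      by_cases hle : (i, j) ≤ (a, b)
      · right
        have h1 : i ≤ a := hle.1
        have h2 : j ≤ b := hle.2
        have hai : a = i := by
          by_contra hne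
          have h3 : (i + 1, j) ∈ lam := lam.up_left_mem (by omega) h2 hab
          rw [mem_iff_lt_rowLen] at h3
          omega
        subst hai
        have h3 := mem_iff_lt_rowLen.1 hab
        simp only [Finset.mem_image, Finset.mem_Ico, Prod.mk.injEq, true_and, exists_eq_right]
        omega
      · left; exact Finset.mem_filter.2 ⟨hab, hle⟩
    have h1 := Finset.card_le_card this
    have h2 := Finset.card_union_le B.cells
      ((Finset.Ico j (lam.rowLen i)).image (fun b => (i, b)))
    have h3 : ((Finset.Ico j (lam.rowLen i)).image (fun b => (i, b))).card ≤ _ :=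
      Finset.card_image_le
    rw [Nat.card_Ico] at h3
    change lam.card ≤ _ at h1
    change _ ≤ B.card + _ at h2
    omega
  obtain ⟨nu, h1, -, h2⟩ := HS_interp lam _ B m le_rfl hAB hB (by omega) hcard
  exact ⟨nu, h1, fun hmem => (Finset.mem_filter.1 (h2 hmem)).2 le_rfl⟩

lemma core_small_steps (lam kap : YoungDiagram) (m b : ℕ)
    (hmm : 2 ≤ m) (hs : m + 2 ≤ lam.rowLen 0)
    (hP : ∀ i, 2 + lam.rowLen i ≤ lam.rowLen 0 + lam.rowLen (i + 1))
    (hE : ∀ nu, HS lam m nu ↔ HS kap b nu.transpose) (i : ℕ) :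
    lam.rowLen i ≤ lam.rowLen (i + 1) + 1 := by
  by_contra hcon
  have hPi := hP i
  obtain ⟨u, hu1, hu2, hu3⟩ : ∃ u, u + 2 + m ≤ lam.rowLen 0 ∧
      u + 2 + lam.rowLen (i + 1) ≤ lam.rowLen i ∧ lam.rowLen i ≤ lam.rowLen (i + 1) + u + m := by
    refine ⟨lam.rowLen i - lam.rowLen (i + 1) - m, ?_, ?_, ?_⟩ <;> omega
  obtain ⟨nu, hnu, hq⟩ := HS_exists_mem lam m i (lam.rowLen (i + 1) + u + 1)
    (mem_iff_lt_rowLen.2 (by omega)) (by omega) (by omega)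
  obtain ⟨nu', hnu', hp⟩ := HS_exists_not_mem lam m i (lam.rowLen (i + 1) + u)
    (by omega) (by omega) (by omega)
  have h1 := ((hE nu).1 hnu).2.1
  have h2 := ((hE nu').1 hnu').1
  have h3 : (lam.rowLen (i + 1) + u + 1, i) ∈ kap := h1 (by
    rw [mem_transpose]; exact hq)
  have h4 := h2 ((mem_minus _ _ _).2 h3)
  rw [mem_transpose] at h4
  exact hp h4

lemma core_s_ge (lam kap : YoungDiagram) (m b : ℕ)
    (hmm : 2 ≤ m) (hs : m < lam.rowLen 1) (hbb : 2 ≤ b) (ht : b < kap.rowLen 1)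
    (hP' : ∀ i, 2 + kap.rowLen i ≤ kap.rowLen 0 + kap.rowLen (i + 1))
    (hE : ∀ nu, HS lam m nu ↔ HS kap b nu.transpose) :
    m + 2 ≤ lam.rowLen 0 := by
  by_contra hcon
  have hanti : lam.rowLen 1 ≤ lam.rowLen 0 := lam.rowLen_anti 0 1 (by omega)
  have hanti' : kap.rowLen 1 ≤ kap.rowLen 0 := kap.rowLen_anti 0 1 (by omega)
  have hE' : ∀ nu, HS kap b nu ↔ HS lam m nu.transpose := by
    intro nu
    rw [hE, transpose_transpose]
  have h1 := card_minus lam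
  have h2 := card_minus kap
  -- every cell outside `minus kap` is avoided
  have havoid : ∀ i j, (i, j) ∈ kap → (i, j) ∉ minus kap →
      ∃ nu, HS kap b nu ∧ (i, j) ∉ nu := by
    intro i j hij hn
    rw [mem_minus, mem_iff_lt_rowLen] at hn
    rw [mem_iff_lt_rowLen] at hij
    refine HS_exists_not_mem kap b i j (by omega) (by omega) ?_
    by_cases htt : b + 2 ≤ kap.rowLen 0
    · have := core_small_steps kap lam b m hbb htt hP' hE' i
      omega
    · have := hP' i
      omega
  have hsub : (minus lam).transpose ≤ minus kap := by
    rintro ⟨i, j⟩ hij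
    obtain ⟨nu0, hnu0, -⟩ := HS_interp kap (minus kap) kap b le_rfl (minus_le kap) le_rfl
      (by omega) (by omega)
    have hall : ∀ nu, HS kap b nu → (i, j) ∈ nu := by
      intro nu hnu
      have h3 := ((hE' nu).1 hnu).1
      have h4 : (j, i) ∈ minus lam := by simpa [mem_transpose] using hij
      have h5 := h3 h4
      rw [mem_transpose] at h5
      exact h5
    by_contra hn
    obtain ⟨nu, hnu, hnn⟩ := havoid i j (hnu0.2.1 (hall nu0 hnu0)) hn
    exact hnn (hall nu hnu)
  obtain ⟨nu0, hnu0, -⟩ := HS_interp kap (minus kap) kap b le_rfl (minus_le kap) le_rfl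
      (by omega) (by omega)
  have hN1 := hnu0.2.2
  have hN2 := ((hE' nu0).1 hnu0).2.2
  have hct : ∀ nu : YoungDiagram, nu.transpose.card = nu.card := by
    intro nu
    change (nu.cells.map _).card = nu.cells.card
    rw [Finset.card_map]
  rw [hct] at hN2
  have hcard := Finset.card_le_card hsub
  change (minus lam).transpose.card ≤ (minus kap).card at hcard
  rw [hct] at hcard
  have hmem : (0, lam.rowLen 0 - 1) ∈ minus lam := by
    rw [mem_minus, mem_iff_lt_rowLen]; simp only [zero_add]; omega
  have hmem2 : (lam.rowLen 0 - 1, 0) ∈ minus kap := hsub (by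
    rw [mem_transpose]; exact hmem)
  rw [mem_minus] at hmem2
  have hr : lam.rowLen 0 - 1 + 1 = lam.rowLen 0 := by omega
  rw [hr] at hmem2
  obtain ⟨nu, hnu, hq⟩ := HS_exists_mem kap b _ _ hmem2 (by omega) (by omega)
  have h5 := ((hE' nu).1 hnu).2.1
  have h6 : (0, lam.rowLen 0) ∈ lam := h5 (by
    rw [mem_transpose]; exact hq)
  rw [mem_iff_lt_rowLen] at h6
  omega

lemma core_le (lam kap : YoungDiagram) (m b : ℕ)
    (hs : m + 2 ≤ lam.rowLen 0)
    (hd : ∀ i, lam.rowLen i ≤ lam.rowLen (i + 1) + 1)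
    (hE : ∀ nu, HS lam m nu ↔ HS kap b nu.transpose) : lam ≤ kap.transpose := by
  rintro ⟨i, j⟩ hij
  have h1 := mem_iff_lt_rowLen.1 hij
  have h2 := hd i
  obtain ⟨nu, hnu, hq⟩ := HS_exists_mem lam m i j hij (by omega) (by omega)
  have h3 := ((hE nu).1 hnu).2.1
  rw [mem_transpose]
  refine h3 ?_
  rw [mem_transpose]; exact hq

lemma core (lam kap : YoungDiagram) (m b : ℕ)
    (hmm : 2 ≤ m) (hs : m < lam.rowLen 1) (hbb : 2 ≤ b) (ht : b < kap.rowLen 1)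
    (hP : ∀ i, 2 + lam.rowLen i ≤ lam.rowLen 0 + lam.rowLen (i + 1))
    (hP' : ∀ i, 2 + kap.rowLen i ≤ kap.rowLen 0 + kap.rowLen (i + 1))
    (hE : ∀ nu, HS lam m nu ↔ HS kap b nu.transpose) :
    lam = kap.transpose ∧ (∀ i, lam.rowLen i ≤ lam.rowLen (i + 1) + 1) ∧
      (∀ i, kap.rowLen i ≤ kap.rowLen (i + 1) + 1) ∧ m = b := by
  have hE' : ∀ nu, HS kap b nu ↔ HS lam m nu.transpose := by
    intro nu
    rw [hE, transpose_transpose]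
  have h1 := core_s_ge lam kap m b hmm hs hbb ht hP' hE
  have h2 := core_s_ge kap lam b m hbb ht hmm hs hP hE'
  have h3 := core_small_steps lam kap m b hmm h1 hP hE
  have h4 := core_small_steps kap lam b m hbb h2 hP' hE'
  have h5 := core_le lam kap m b h1 h3 hE
  have h6 := core_le kap lam b m h2 h4 hE'
  have h7 : lam = kap.transpose := by
    refine le_antisymm h5 ?_
    have := YoungDiagram.transpose_mono h6
    rwa [transpose_transpose] at this
  refine ⟨h7, h3, h4, ?_⟩
  have hc := card_minus lam
  obtain ⟨nu0, hnu0, -⟩ := HS_interp lam (minus lam) lam m le_rfl (minus_le lam) le_rfl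
      (by omega) (by omega)
  have hN1 := hnu0.2.2
  have hN2 := ((hE nu0).1 hnu0).2.2
  have hct : ∀ nu : YoungDiagram, nu.transpose.card = nu.card := by
    intro nu
    change (nu.cells.map _).card = nu.cells.card
    rw [Finset.card_map]
  rw [hct] at hN2
  rw [h7, hct] at hN1
  omega

lemma eq_staircase (lam : YoungDiagram) (h1 : ∀ i, lam.rowLen i ≤ lam.rowLen (i + 1) + 1)
    (h2 : ∀ i, lam.colLen i ≤ lam.colLen (i + 1) + 1) : lam = staircase (lam.rowLen 0) := by
  have hstep : ∀ i, lam.rowLen (i + 1) = lam.rowLen i - 1 := by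
    intro i
    have ha := h1 i
    have hb : lam.rowLen (i + 1) ≤ lam.rowLen i := lam.rowLen_anti i (i + 1) (by omega)
    by_contra hne
    have hpos : 0 < lam.rowLen i := by omega
    have hc := h2 (lam.rowLen i - 1)
    rw [Nat.sub_add_cancel hpos] at hc
    have hx : (i + 1, lam.rowLen i - 1) ∈ lam := mem_iff_lt_rowLen.2 (by omega)
    have hy : (i, lam.rowLen i) ∉ lam := by rw [mem_iff_lt_rowLen]; omega
    rw [mem_iff_lt_colLen] at hx hy
    omega
  have hrow : ∀ i, lam.rowLen i = lam.rowLen 0 - i := by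
    intro i
    induction i with
    | zero => rfl
    | succ i ih => rw [hstep, ih]; omega
  ext ⟨i, j⟩
  rw [mem_cells, mem_iff_lt_rowLen, hrow i]
  simp only [staircase, Finset.mem_filter, Finset.mem_product, Finset.mem_range]
  omega

lemma dp_row (lam : YoungDiagram) (h : 4 ≤ dp lam) (i : ℕ) :
    2 + lam.rowLen i ≤ lam.rowLen 0 + lam.rowLen (i + 1) := by
  have hsub : ((Finset.range (lam.colLen 0)).image fun i => lam.rowLen i) ⊆
      Finset.Icc 1 (lam.rowLen (i + 1)) ∪ Finset.Icc (lam.rowLen i) (lam.rowLen 0) := by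
    intro v hv
    simp only [Finset.mem_image, Finset.mem_range] at hv
    obtain ⟨k, hk, rfl⟩ := hv
    have h0 : 0 < lam.rowLen k := mem_iff_lt_rowLen.1 (mem_iff_lt_colLen.2 hk)
    simp only [Finset.mem_union, Finset.mem_Icc]
    rcases Nat.lt_or_ge i k with hik | hik
    · left; exact ⟨h0, lam.rowLen_anti (i + 1) k hik⟩
    · right; exact ⟨lam.rowLen_anti k i hik, lam.rowLen_anti 0 k (by omega)⟩
  have h1 := Finset.card_le_card hsub
  have h2 := Finset.card_union_le (Finset.Icc 1 (lam.rowLen (i + 1)))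
    (Finset.Icc (lam.rowLen i) (lam.rowLen 0))
  rw [Nat.card_Icc, Nat.card_Icc] at h2
  have h3 : lam.rowLen i ≤ lam.rowLen 0 := lam.rowLen_anti 0 i (by omega)
  unfold dp at h
  omega

lemma dp_col (lam : YoungDiagram) (h : 4 ≤ dp lam) (j : ℕ) :
    2 + lam.colLen j ≤ lam.colLen 0 + lam.colLen (j + 1) := by
  have hsub : ((Finset.range (lam.colLen 0)).image fun i => lam.rowLen i) ⊆
      {j + 1} ∪ ((Finset.range (lam.colLen (j + 1)) ∪
        Finset.Ico (lam.colLen j) (lam.colLen 0)).image fun i => lam.rowLen i) := by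
    intro v hv
    simp only [Finset.mem_image, Finset.mem_range] at hv
    obtain ⟨k, hk, rfl⟩ := hv
    simp only [Finset.mem_union, Finset.mem_singleton, Finset.mem_image, Finset.mem_range,
      Finset.mem_Ico]
    by_cases hx : lam.rowLen k = j + 1
    · left; exact hx
    · right
      refine ⟨k, ?_, rfl⟩
      rw [← mem_iff_lt_colLen, mem_iff_lt_rowLen]
      by_cases hy : j + 1 < lam.rowLen k
      · left; exact hy
      · right
        refine ⟨?_, hk⟩
        rw [← not_lt, ← mem_iff_lt_colLen, mem_iff_lt_rowLen]
        omega
  have h1 := Finset.card_le_card hsub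
  have h2 := Finset.card_union_le {j + 1} ((Finset.range (lam.colLen (j + 1)) ∪
        Finset.Ico (lam.colLen j) (lam.colLen 0)).image fun i => lam.rowLen i)
  have h3 : ((Finset.range (lam.colLen (j + 1)) ∪
        Finset.Ico (lam.colLen j) (lam.colLen 0)).image fun i => lam.rowLen i).card ≤ _ :=
    Finset.card_image_le
  have h4 := Finset.card_union_le (Finset.range (lam.colLen (j + 1)))
    (Finset.Ico (lam.colLen j) (lam.colLen 0))
  rw [Finset.card_range, Nat.card_Ico] at h4
  rw [Finset.card_singleton] at h2
  have h5 : lam.colLen j ≤ lam.colLen 0 := lam.colLen_anti 0 j (by omega)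
  unfold dp at h
  omega

lemma mem_skew (lam mu : YoungDiagram) (i j : ℕ) :
    (i, j) ∈ skewCells lam mu ↔ j < lam.rowLen i ∧ mu.rowLen i ≤ j := by
  rw [skewCells, Finset.mem_sdiff, mem_cells, mem_cells, mem_iff_lt_rowLen, mem_iff_lt_rowLen,
    not_lt]

lemma card_eq_sum (nu : YoungDiagram) (L : ℕ) (h : nu.colLen 0 ≤ L) :
    nu.card = ∑ i ∈ Finset.range L, nu.rowLen i := by
  have h1 : ∀ p ∈ nu.cells, p.1 ∈ Finset.range L := by
    rintro ⟨i, j⟩ hp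
    have h2 : (i, 0) ∈ nu := nu.up_left_mem le_rfl (Nat.zero_le j) hp
    rw [mem_iff_lt_colLen] at h2
    simp only [Finset.mem_range]
    omega
  have h3 := Finset.card_eq_sum_card_fiberwise (f := Prod.fst) (s := nu.cells) h1
  change nu.cells.card = _
  rw [h3]
  refine Finset.sum_congr rfl fun i _ => ?_
  rw [rowLen_eq_card]
  congr 1

lemma LR_le (lam mu nu : YoungDiagram) (T : ℕ × ℕ → ℕ) (h : IsLR lam mu nu T) (i : ℕ) :
    ∀ j, (i, j) ∈ skewCells lam mu → T (i, j) ≤ i + 1 := by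
  induction i using Nat.strong_induction_on with
  | _ i ih =>
    intro j hj
    by_contra hcon
    obtain ⟨k, hk⟩ : ∃ k, T (i, j) = k + 2 := ⟨T (i, j) - 2, by omega⟩
    have hl := h.2.1 i j k
    have hpos : 0 < prefixCount lam mu T i j (k + 2) := by
      unfold prefixCount
      rw [Finset.card_pos]
      exact ⟨(i, j), Finset.mem_filter.2 ⟨hj, Or.inr ⟨rfl, le_rfl⟩, hk⟩⟩
    have hpos2 := hpos.trans_le hl
    unfold prefixCount at hpos2
    rw [Finset.card_pos] at hpos2
    obtain ⟨⟨a, c⟩, hp⟩ := hpos2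
    obtain ⟨hp1, hp2, hp3⟩ := Finset.mem_filter.1 hp
    rcases hp2 with hp2 | ⟨hp2, hp4⟩
    · have := ih a hp2 c hp1
      simp only at hp2
      omega
    · simp only at hp2 hp4
      subst hp2
      have := h.1.2.1 a j c hj hp1 hp4
      omega

lemma LR_finite (lam mu nu : YoungDiagram) : {T : ℕ × ℕ → ℕ | IsLR lam mu nu T}.Finite := by
  have hfin : (Set.pi Set.univ (fun _ : skewCells lam mu => Set.Iic (lam.colLen 0))).Finite :=
    Set.Finite.pi fun _ => Set.finite_Iic _
  refine Set.Finite.of_injOn (f := fun T (p : skewCells lam mu) => T p.1) ?_ ?_ hfin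
  · rintro T hT ⟨⟨i, j⟩, hp⟩ -
    have h1 := LR_le lam mu nu T hT i j hp
    rw [mem_skew] at hp
    have h2 : (i, 0) ∈ lam := mem_iff_lt_rowLen.2 (by omega)
    rw [mem_iff_lt_colLen] at h2
    simp only [Set.mem_Iic]
    omega
  · intro T hT T' hT' heq
    funext p
    by_cases hp : p ∈ skewCells lam mu
    · exact congrFun heq ⟨p, hp⟩
    · have h1 := hT.1.1 p
      have h2 := hT'.1.1 p
      have h3 : T p = 0 := by by_contra hne; exact hp (h1.2 hne)
      have h4 : T' p = 0 := by by_contra hne; exact hp (h2.2 hne)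
      rw [h3, h4]

lemma lrCoeff_ne_zero (lam mu nu : YoungDiagram) (hmu : mu ≤ lam) :
    lrCoeff lam mu nu ≠ 0 ↔ ∃ T, IsLR lam mu nu T := by
  unfold lrCoeff
  rw [if_pos hmu]
  rw [Ne, Set.ncard_eq_zero (LR_finite lam mu nu), ← Ne, ← Set.nonempty_iff_ne_empty]
  rfl

lemma LR_nu_le (lam mu nu : YoungDiagram) (T : ℕ × ℕ → ℕ) (h : IsLR lam mu nu T) (k : ℕ) :
    nu.rowLen k ≤ lam.rowLen k := by
  rw [← h.2.2 k]
  unfold content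
  have : (Finset.range (lam.rowLen k)).card = lam.rowLen k := Finset.card_range _
  rw [← this]
  refine Finset.card_le_card_of_injOn Prod.snd ?_ ?_
  · rintro ⟨i, j⟩ hp
    obtain ⟨hp1, hp2⟩ := Finset.mem_filter.1 (Finset.mem_coe.1 hp)
    have h1 := LR_le lam mu nu T h i j hp1
    rw [mem_skew] at hp1
    have h2 := lam.rowLen_anti k i (by omega)
    simp only [Finset.coe_range, Set.mem_Iio]
    omega
  · rintro ⟨i, j⟩ hp ⟨i', j'⟩ hp' heq
    obtain ⟨hp1, hp2⟩ := Finset.mem_filter.1 (Finset.mem_coe.1 hp)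
    obtain ⟨hp1', hp2'⟩ := Finset.mem_filter.1 (Finset.mem_coe.1 hp')
    simp only at heq
    subst heq
    rcases lt_trichotomy i i' with hlt | heq | hlt
    · have := h.1.2.2 i i' j hp1 hp1' hlt; omega
    · rw [heq]
    · have := h.1.2.2 i' i j hp1' hp1 hlt; omega

lemma le_of_rowLen (nu lam : YoungDiagram) (h : ∀ k, nu.rowLen k ≤ lam.rowLen k) : nu ≤ lam := by
  rintro ⟨i, j⟩ hp
  have h1 := mem_iff_lt_rowLen.1 hp
  exact mem_iff_lt_rowLen.2 (h1.trans_le (h i))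

lemma LR_card (lam mu nu : YoungDiagram) (T : ℕ × ℕ → ℕ) (hmu : mu ≤ lam)
    (h : IsLR lam mu nu T) : nu.card + mu.card = lam.card := by
  have h0 : (skewCells lam mu).card + mu.card = lam.card :=
    Finset.card_sdiff_add_card_eq_card hmu
  rw [← h0, card_eq_sum nu (lam.colLen 0)]
  · congr 1
    have h1 : ∀ p ∈ skewCells lam mu, T p - 1 ∈ Finset.range (lam.colLen 0) := by
      rintro ⟨i, j⟩ hp
      have h1 := LR_le lam mu nu T h i j hp
      rw [mem_skew] at hp
      have h2 : (i, 0) ∈ lam := mem_iff_lt_rowLen.2 (by omega)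
      rw [mem_iff_lt_colLen] at h2
      simp only [Finset.mem_range]
      omega
    rw [Finset.card_eq_sum_card_fiberwise h1]
    refine Finset.sum_congr rfl fun i _ => ?_
    rw [← h.2.2 i]
    unfold content
    congr 1
    ext p
    simp only [Finset.mem_filter, and_congr_right_iff]
    intro hp
    have := (h.1.1 p).1 hp
    omega
  · by_contra hcon
    have h2 : (lam.colLen 0, 0) ∈ nu := mem_iff_lt_colLen.2 (by omega)
    have h3 := le_of_rowLen nu lam (LR_nu_le lam mu nu T h) h2
    change (lam.colLen 0, 0) ∈ lam at h3
    rw [mem_iff_lt_colLen] at h3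
    omega

lemma rowLen_of_row (mu : YoungDiagram) (hm : mu.colLen 0 = 1) (i : ℕ) (hi : 0 < i) :
    mu.rowLen i = 0 := by
  by_contra hne
  have : (i, 0) ∈ mu := mem_iff_lt_rowLen.2 (by omega)
  rw [mem_iff_lt_colLen] at this
  omega

lemma card_of_row (mu : YoungDiagram) (hm : mu.colLen 0 = 1) : mu.card = mu.rowLen 0 := by
  rw [card_eq_sum mu 1 (by omega)]
  simp

lemma row_nec (lam mu nu : YoungDiagram) (T : ℕ × ℕ → ℕ) (hmu : mu ≤ lam)
    (hm : mu.colLen 0 = 1) (h : IsLR lam mu nu T) : HS lam (mu.rowLen 0) nu := by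
  have hlow : ∀ i j, (i, j) ∈ skewCells lam mu → i ≤ T (i, j) := by
    intro i
    induction i with
    | zero => intro j _; omega
    | succ i ih =>
      intro j hj
      rcases Nat.eq_zero_or_pos i with rfl | hi
      · have := (h.1.1 _).1 hj
        omega
      · have hj' : (i, j) ∈ skewCells lam mu := by
          rw [mem_skew] at hj ⊢
          rw [rowLen_of_row mu hm i hi]
          have := lam.rowLen_anti i (i + 1) (by omega)
          omega
        have h1 := ih j hj'
        have h2 := h.1.2.2 i (i + 1) j hj' hj (by omega)
        omega
  refine ⟨?_, le_of_rowLen _ _ (LR_nu_le lam mu nu T h), ?_⟩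
  · refine le_of_rowLen _ _ fun k => ?_
    have hrow : (minus lam).rowLen k = lam.rowLen (k + 1) := by
      refine eq_of_forall_lt_iff fun c => ?_
      rw [← mem_iff_lt_rowLen, ← mem_iff_lt_rowLen, mem_minus]
    rw [hrow]
    have hsk : ∀ j, (k + 1, j) ∈ skewCells lam mu ↔ j < lam.rowLen (k + 1) := by
      intro j
      rw [mem_skew, rowLen_of_row mu hm (k + 1) (by omega)]
      simp
    have hval : ∀ j, j < lam.rowLen (k + 1) → T (k + 1, j) = k + 1 ∨ T (k + 1, j) = k + 2 := by
      intro j hj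
      have h1 := LR_le lam mu nu T h (k + 1) j ((hsk j).2 hj)
      have h2 := hlow (k + 1) j ((hsk j).2 hj)
      omega
    set S := (Finset.range (lam.rowLen (k + 1))).filter (fun j => T (k + 1, j) = k + 1) with hS
    set S' := (Finset.range (lam.rowLen (k + 1))).filter (fun j => ¬ T (k + 1, j) = k + 1) with hS'
    have hSS : S.card + S'.card = lam.rowLen (k + 1) := by
      rw [hS, hS', Finset.card_filter_add_card_filter_not, Finset.card_range]
    obtain ⟨j0, hj0⟩ : ∃ j0, ∀ j, j < lam.rowLen (k + 1) → (T (k + 1, j) = k + 2 ↔ j0 ≤ j) := by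
      by_cases hex : ∃ j, j < lam.rowLen (k + 1) ∧ T (k + 1, j) = k + 2
      · refine ⟨Nat.find hex, fun j hj => ⟨fun hv => Nat.find_min' hex ⟨hj, hv⟩, fun hle => ?_⟩⟩
        have h1 := Nat.find_spec hex
        have h2 := h.1.2.1 (k + 1) _ j ((hsk _).2 h1.1) ((hsk _).2 hj) hle
        have h3 := hval j hj
        omega
      · push Not at hex
        refine ⟨lam.rowLen (k + 1), fun j hj => ⟨fun hv => absurd hv (hex j hj), fun hle => ?_⟩⟩
        omega
    have hl := h.2.1 (k + 1) j0 k
    have hA : S'.card ≤ prefixCount lam mu T (k + 1) j0 (k + 2) := by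
      unfold prefixCount
      refine Finset.card_le_card_of_injOn (fun j => (k + 1, j)) ?_ ?_
      · intro j hj
        obtain ⟨hj1, hj2⟩ := Finset.mem_filter.1 (Finset.mem_coe.1 hj)
        rw [Finset.mem_range] at hj1
        have h3 := hval j hj1
        have h4 : T (k + 1, j) = k + 2 := by tauto
        exact Finset.mem_coe.2 (Finset.mem_filter.2
          ⟨(hsk j).2 hj1, Or.inr ⟨rfl, (hj0 j hj1).1 h4⟩, h4⟩)
      · intro a _ b _ hab
        exact (Prod.mk.inj hab).2
    have hB : prefixCount lam mu T (k + 1) j0 (k + 1) + S.card ≤ content lam mu T (k + 1) := by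
      unfold prefixCount content
      have hc : S.card = (S.image (fun j => (k + 1, j))).card := by
        rw [Finset.card_image_of_injective]
        intro a b hab
        exact (Prod.mk.inj hab).2
      rw [hc, ← Finset.card_union_of_disjoint]
      · refine Finset.card_le_card ?_
        intro p hp
        rcases Finset.mem_union.1 hp with hp | hp
        · obtain ⟨h1, -, h2⟩ := Finset.mem_filter.1 hp
          exact Finset.mem_filter.2 ⟨h1, h2⟩
        · obtain ⟨j, hj, rfl⟩ := Finset.mem_image.1 hp
          obtain ⟨hj1, hj2⟩ := Finset.mem_filter.1 hj
          rw [Finset.mem_range] at hj1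
          exact Finset.mem_filter.2 ⟨(hsk j).2 hj1, hj2⟩
      · rw [Finset.disjoint_left]
        intro p hp hp'
        obtain ⟨j, hj, rfl⟩ := Finset.mem_image.1 hp'
        obtain ⟨hj1, hj2⟩ := Finset.mem_filter.1 hj
        rw [Finset.mem_range] at hj1
        obtain ⟨-, h1, -⟩ := Finset.mem_filter.1 hp
        simp only [lt_self_iff_false, true_and, false_or] at h1
        have := (hj0 j hj1).2 h1
        omega
    rw [h.2.2 k] at hB
    omega
  · rw [← card_of_row mu hm]
    exact LR_card lam mu nu T hmu h

lemma row_suf (lam mu nu : YoungDiagram)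
    (hm : mu.colLen 0 = 1) (h : HS lam (mu.rowLen 0) nu) : ∃ T, IsLR lam mu nu T := by
  obtain ⟨h1, h2, h3⟩ := h
  have hle : ∀ k, nu.rowLen k ≤ lam.rowLen k := by
    intro k
    by_contra hcon
    have hx : (k, lam.rowLen k) ∈ nu := mem_iff_lt_rowLen.2 (by omega)
    have hy : (k, lam.rowLen k) ∈ lam := h2 hx
    rw [mem_iff_lt_rowLen] at hy
    omega
  have hge : ∀ k, lam.rowLen (k + 1) ≤ nu.rowLen k := by
    intro k
    by_contra hcon
    have hx : (k, nu.rowLen k) ∈ minus lam := (mem_minus _ _ _).2 (mem_iff_lt_rowLen.2 (by omega))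
    have hy : (k, nu.rowLen k) ∈ nu := h1 hx
    rw [mem_iff_lt_rowLen] at hy
    omega
  have hL0 : ∀ k, lam.colLen 0 ≤ k → lam.rowLen k = 0 := by
    intro k hk
    by_contra hne
    have : (k, 0) ∈ lam := mem_iff_lt_rowLen.2 (by omega)
    rw [mem_iff_lt_colLen] at this
    omega
  obtain ⟨a, ha0, hastep, hale⟩ : ∃ a : ℕ → ℕ, a 0 = mu.rowLen 0 ∧
      (∀ k, a k = a (k + 1) + (lam.rowLen k - nu.rowLen k)) ∧ ∀ k, a k ≤ lam.rowLen k := by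
    let a : ℕ → ℕ := fun k => ∑ i ∈ Finset.Ico k (lam.colLen 0), (lam.rowLen i - nu.rowLen i)
    have hstep : ∀ k, a k = a (k + 1) + (lam.rowLen k - nu.rowLen k) := by
      intro k
      rcases Nat.lt_or_ge k (lam.colLen 0) with hk | hk
      · simp only [a]
        rw [Finset.sum_eq_sum_Ico_succ_bot hk, add_comm]
      · simp only [a]
        rw [Finset.Ico_eq_empty (by omega), Finset.Ico_eq_empty (by omega), hL0 k hk]
        simp
    refine ⟨a, ?_, hstep, ?_⟩
    · have hc1 := card_eq_sum lam (lam.colLen 0) le_rfl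
      have hc2 := card_eq_sum nu (lam.colLen 0) (by
        by_contra hcon
        have h4 : (lam.colLen 0, 0) ∈ nu := mem_iff_lt_colLen.2 (by omega)
        have h5 : (lam.colLen 0, 0) ∈ lam := h2 h4
        rw [mem_iff_lt_colLen] at h5
        omega)
      have hc3 : a 0 + ∑ i ∈ Finset.range (lam.colLen 0), nu.rowLen i =
          ∑ i ∈ Finset.range (lam.colLen 0), lam.rowLen i := by
        simp only [a]
        rw [← Finset.range_eq_Ico, ← Finset.sum_add_distrib]
        refine Finset.sum_congr rfl fun i _ => ?_
        have := hle i
        omega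
      omega
    · have : ∀ d k, lam.colLen 0 ≤ k + d → a k ≤ lam.rowLen k := by
        intro d
        induction d with
        | zero =>
          intro k hk
          simp only [a]
          rw [Finset.Ico_eq_empty (by omega)]
          simp
        | succ d ih =>
          intro k hk
          have h4 := ih (k + 1) (by omega)
          rw [hstep k]
          have := hge k
          have := hle k
          omega
      intro k
      exact this (lam.colLen 0) k (by omega)
  have hsk : ∀ i j, (i, j) ∈ skewCells lam mu ↔ j < lam.rowLen i ∧ (i = 0 → a 0 ≤ j) := by
    intro i j
    rw [mem_skew]
    rcases Nat.eq_zero_or_pos i with rfl | hi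
    · rw [ha0]; simp
    · rw [rowLen_of_row mu hm i hi]
      constructor
      · rintro ⟨h4, -⟩; exact ⟨h4, by omega⟩
      · rintro ⟨h4, -⟩; exact ⟨h4, by omega⟩
  let T : ℕ × ℕ → ℕ := fun p =>
    if p ∈ skewCells lam mu then (if p.2 < a p.1 then p.1 else p.1 + 1) else 0
  have hTin : ∀ i j, (i, j) ∈ skewCells lam mu → T (i, j) = if j < a i then i else i + 1 := by
    intro i j hij
    simp only [T]
    rw [if_pos hij]
  have hTout : ∀ p, p ∉ skewCells lam mu → T p = 0 := by
    intro p hp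
    simp only [T]
    rw [if_neg hp]
  have hanti : ∀ i i', i ≤ i' → a i' ≤ a i := by
    intro i i' hii
    induction hii with
    | refl => exact le_rfl
    | step _ ih => exact le_trans (by rename_i n _; have := hastep n; simp only [Nat.succ_eq_add_one]; omega) ih
  have hT : ∀ i j k, ((i, j) ∈ skewCells lam mu ∧ T (i, j) = k + 1) ↔
      ((i = k ∧ a k ≤ j ∧ j < lam.rowLen k) ∨ (i = k + 1 ∧ j < a (k + 1))) := by
    intro i j k
    constructor
    · rintro ⟨hij, hv⟩
      rw [hTin i j hij] at hv
      rw [hsk] at hij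
      split_ifs at hv with hlt
      · right; subst hv; exact ⟨rfl, hlt⟩
      · left
        have : i = k := by omega
        subst this
        exact ⟨rfl, by omega, hij.1⟩
    · rintro (⟨rfl, h4, h5⟩ | ⟨rfl, h4⟩)
      · have hij : (i, j) ∈ skewCells lam mu := (hsk i j).2 ⟨h5, by rintro rfl; exact h4⟩
        refine ⟨hij, ?_⟩
        rw [hTin i j hij, if_neg (by omega)]
      · have := hale (k + 1)
        have hij : (k + 1, j) ∈ skewCells lam mu := (hsk _ j).2 ⟨by omega, by omega⟩
        refine ⟨hij, ?_⟩
        rw [hTin _ j hij, if_pos h4]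
  refine ⟨T, ⟨?_, ?_, ?_⟩, ?_, ?_⟩
  · rintro ⟨i, j⟩
    constructor
    · intro hij
      rw [hTin i j hij]
      rw [hsk] at hij
      split_ifs with hlt
      · rintro rfl
        have := hij.2 rfl
        omega
      · omega
    · intro hne
      by_contra hn
      exact hne (hTout _ hn)
  · intro i j1 j2 hj1 hj2 hle'
    rw [hTin i j1 hj1, hTin i j2 hj2]
    split_ifs <;> omega
  · intro i1 i2 j hi1 hi2 hlt
    rw [hTin i1 j hi1, hTin i2 j hi2]
    have := hanti i1 i2 hlt.le
    split_ifs <;> omega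
  · intro i j k
    unfold prefixCount
    have hx1 := hastep k
    have hx2 := hastep (k + 1)
    have hx3 := hle k
    have hx4 := hge k
    refine Finset.card_le_card_of_injOn
      (fun p => if p.1 = k + 1 then (k, p.2 + (lam.rowLen k - nu.rowLen k)) else (k + 1, p.2)) ?_ ?_
    · rintro ⟨i', j'⟩ hp
      obtain ⟨hp1, hp2, hp3⟩ := Finset.mem_filter.1 (Finset.mem_coe.1 hp)
      have hp4 := (hT i' j' (k + 1)).1 ⟨hp1, hp3⟩
      refine Finset.mem_coe.2 (Finset.mem_filter.2 ?_)
      simp only at hp2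
      rcases hp4 with ⟨rfl, h4, h5⟩ | ⟨rfl, h4⟩
      · simp only [if_true]
        have h6 := (hT k (j' + (lam.rowLen k - nu.rowLen k)) k).2 (Or.inl ⟨rfl, by omega, by omega⟩)
        exact ⟨h6.1, Or.inl (by omega), h6.2⟩
      · have hne : ¬ (k + 1 + 1 = k + 1) := by omega
        simp only [hne, if_false]
        have h6 := (hT (k + 1) j' k).2 (Or.inr ⟨rfl, by omega⟩)
        exact ⟨h6.1, by omega, h6.2⟩
    · rintro ⟨i', j'⟩ hp ⟨i'', j''⟩ hp' heq
      obtain ⟨hp1, hp2, hp3⟩ := Finset.mem_filter.1 (Finset.mem_coe.1 hp)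
      have hp4 := (hT i' j' (k + 1)).1 ⟨hp1, hp3⟩
      obtain ⟨hp1', hp2', hp3'⟩ := Finset.mem_filter.1 (Finset.mem_coe.1 hp')
      have hp4' := (hT i'' j'' (k + 1)).1 ⟨hp1', hp3'⟩
      simp only at heq
      simp only [Prod.mk.injEq]
      split_ifs at heq with c1 c2 c2 <;> simp only [Prod.mk.injEq] at heq <;> omega
  · intro k
    unfold content
    have hset : ((skewCells lam mu).filter fun p => T p = k + 1) =
        (Finset.Ico (a k) (lam.rowLen k)).image (fun j => (k, j)) ∪
          (Finset.range (a (k + 1))).image (fun j => (k + 1, j)) := by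
      ext ⟨i, j⟩
      rw [Finset.mem_filter, hT i j k, Finset.mem_union]
      simp only [Finset.mem_image, Finset.mem_Ico, Finset.mem_range, Prod.mk.injEq,
        exists_eq_right_right]
      constructor
      · rintro (⟨rfl, h4⟩ | ⟨rfl, h4⟩)
        · left; exact ⟨h4, rfl⟩
        · right; exact ⟨h4, rfl⟩
      · rintro (⟨h4, rfl⟩ | ⟨h4, rfl⟩)
        · left; exact ⟨rfl, h4⟩
        · right; exact ⟨rfl, h4⟩
    rw [hset, Finset.card_union_of_disjoint, Finset.card_image_of_injective,
      Finset.card_image_of_injective, Nat.card_Ico, Finset.card_range]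
    · have := hastep k
      have := hle k
      have := hale k
      omega
    · intro x y hxy; exact (Prod.mk.inj hxy).2
    · intro x y hxy; exact (Prod.mk.inj hxy).2
    · rw [Finset.disjoint_left]
      rintro ⟨i, j⟩ hp hp'
      simp only [Finset.mem_image, Prod.mk.injEq] at hp hp'
      obtain ⟨_, _, h4, _⟩ := hp
      obtain ⟨_, _, h5, _⟩ := hp'
      omega

lemma rowLen_of_col (bet : YoungDiagram) (hb : bet.rowLen 0 = 1) (i : ℕ) :
    bet.rowLen i = if i < bet.colLen 0 then 1 else 0 := by
  have h1 : bet.rowLen i ≤ bet.rowLen 0 := bet.rowLen_anti 0 i (by omega)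
  have h2 : 0 < bet.rowLen i ↔ i < bet.colLen 0 := by
    rw [← mem_iff_lt_rowLen, mem_iff_lt_colLen]
  split_ifs with h
  · have := h2.2 h; omega
  · by_contra hne
    exact h (h2.1 (by omega))

lemma card_transpose (nu : YoungDiagram) : nu.transpose.card = nu.card := by
  change (nu.cells.map _).card = nu.cells.card
  rw [Finset.card_map]

lemma card_of_col (bet : YoungDiagram) (hb : bet.rowLen 0 = 1) : bet.card = bet.colLen 0 := by
  rw [← card_transpose, card_of_row, rowLen_transpose]
  rw [colLen_transpose, hb]

lemma mem_skew_col (alp bet : YoungDiagram) (hb : bet.rowLen 0 = 1) (i j : ℕ) :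
    (i, j) ∈ skewCells alp bet ↔ j < alp.rowLen i ∧ (j = 0 → bet.colLen 0 ≤ i) := by
  rw [mem_skew, rowLen_of_col bet hb]
  split_ifs <;> omega

lemma HS_col_iff (alp nu : YoungDiagram) (b : ℕ) : HS alp.transpose b nu.transpose ↔
    (∀ k, nu.rowLen k ≤ alp.rowLen k) ∧ (∀ k, alp.rowLen k ≤ nu.rowLen k + 1) ∧
      nu.card + b = alp.card := by
  unfold HS
  rw [card_transpose, card_transpose, transpose_le_iff]
  constructor
  · rintro ⟨h1, h2, h3⟩
    refine ⟨fun k => ?_, fun k => ?_, h3⟩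
    · by_contra hcon
      have hx : (k, alp.rowLen k) ∈ nu := mem_iff_lt_rowLen.2 (by omega)
      have hy : (k, alp.rowLen k) ∈ alp := h2 hx
      rw [mem_iff_lt_rowLen] at hy
      omega
    · by_contra hcon
      have hx : (k, nu.rowLen k + 1) ∈ alp := mem_iff_lt_rowLen.2 (by omega)
      have hy : (nu.rowLen k, k) ∈ minus alp.transpose := by
        rw [mem_minus, mem_transpose]; exact hx
      have hz : (nu.rowLen k, k) ∈ nu.transpose := h1 hy
      rw [mem_transpose] at hz
      have hlt : nu.rowLen k < nu.rowLen k := mem_iff_lt_rowLen.1 hz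
      omega
  · rintro ⟨h1, h2, h3⟩
    refine ⟨?_, le_of_rowLen _ _ h1, h3⟩
    rintro ⟨j, i⟩ hp
    have hp' : (j, i) ∈ minus alp.transpose := hp
    rw [mem_minus, mem_transpose] at hp'
    have h4 : j + 1 < alp.rowLen i := mem_iff_lt_rowLen.1 hp'
    change (j, i) ∈ nu.transpose
    rw [mem_transpose]
    have h5 := h2 i
    change (i, j) ∈ nu
    exact mem_iff_lt_rowLen.2 (by omega)

lemma col_nec (alp bet nu : YoungDiagram) (T : ℕ × ℕ → ℕ) (hbet : bet ≤ alp)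
    (hb : bet.rowLen 0 = 1) (h : IsLR alp bet nu T) :
    HS alp.transpose (bet.colLen 0) nu.transpose := by
  rw [HS_col_iff]
  have hsk := mem_skew_col alp bet hb
  have hlow : ∀ i j, 1 ≤ j → (i, j) ∈ skewCells alp bet → i + 1 ≤ T (i, j) := by
    intro i
    induction i with
    | zero =>
      intro j _ hj
      have := (h.1.1 _).1 hj
      omega
    | succ i ih =>
      intro j h1 hj
      have hj' : (i, j) ∈ skewCells alp bet := by
        rw [hsk] at hj ⊢
        have := alp.rowLen_anti i (i + 1) (by omega)
        omega
      have h3 := ih j h1 hj'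
      have h2 := h.1.2.2 i (i + 1) j hj' hj (by omega)
      omega
  refine ⟨LR_nu_le alp bet nu T h, fun k => ?_, ?_⟩
  · have hc : ((Finset.Ico 1 (alp.rowLen k)).image (fun j => (k, j))).card = alp.rowLen k - 1 := by
      rw [Finset.card_image_of_injective, Nat.card_Ico]
      intro x y hxy; exact (Prod.mk.inj hxy).2
    have hle : ((Finset.Ico 1 (alp.rowLen k)).image (fun j => (k, j))).card ≤
        content alp bet T (k + 1) := by
      unfold content
      refine Finset.card_le_card ?_
      intro p hp
      obtain ⟨j, hj, rfl⟩ := Finset.mem_image.1 hp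
      rw [Finset.mem_Ico] at hj
      have hs : (k, j) ∈ skewCells alp bet := (hsk k j).2 ⟨hj.2, by omega⟩
      refine Finset.mem_filter.2 ⟨hs, ?_⟩
      have h1 := hlow k j hj.1 hs
      have h2 := LR_le alp bet nu T h k j hs
      omega
    rw [h.2.2 k] at hle
    omega
  · rw [← card_of_col bet hb]
    exact LR_card alp bet nu T hbet h

lemma exists_enum (p : ℕ → Prop) (l b : ℕ) (hp : ∀ k, p k → k < l)
    (hc : ((Finset.range l).filter p).card + b = l) :
    ∃ c : ℕ → ℕ, (∀ i, b ≤ i → i < l → p (c i) ∧ c i ≤ i) ∧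
      (∀ i i', b ≤ i → i < i' → i' < l → c i < c i') ∧
      (∀ k, p k → ∃ i, b ≤ i ∧ i < l ∧ c i = k) := by
  have hcard : ∀ hf : (Set.ofPred p).Finite, hf.toFinset.card + b = l := by
    intro hf
    rw [← hc]
    congr 2
    ext k
    simp only [Set.Finite.mem_toFinset, Finset.mem_filter, Finset.mem_range]
    constructor
    · intro h; exact ⟨hp k h, h⟩
    · intro h; exact h.2
  have hcount : Nat.count p l + b = l := by
    rw [Nat.count_eq_card_filter_range]; exact hc
  refine ⟨fun i => Nat.nth p (i - b), ?_, ?_, ?_⟩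
  · intro i hbi hil
    refine ⟨Nat.nth_mem _ fun hf => by have := hcard hf; omega, ?_⟩
    have h1 : Nat.nth p (i - b) < i + 1 := by
      refine Nat.nth_lt_of_lt_count ?_
      have h2 : Nat.count p l = Nat.count p (i + 1) +
          Nat.count (fun k => p (i + 1 + k)) (l - (i + 1)) := by
        rw [← Nat.count_add]
        congr 1
        omega
      have h3 : Nat.count (fun k => p (i + 1 + k)) (l - (i + 1)) ≤ l - (i + 1) := Nat.count_le _
      omega
    simp only
    omega
  · intro i i' hbi hii hil
    exact Nat.nth_lt_nth' (by omega) fun hf => by have := hcard hf; omega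
  · intro k hk
    refine ⟨Nat.count p k + b, by omega, ?_, ?_⟩
    · have h1 : Nat.count p k < Nat.count p l := Nat.count_strict_mono hk (hp k hk)
      omega
    · simp only [Nat.add_sub_cancel]
      exact Nat.nth_count hk

lemma col_suf (alp bet nu : YoungDiagram) (hb : bet.rowLen 0 = 1)
    (h : HS alp.transpose (bet.colLen 0) nu.transpose) : ∃ T, IsLR alp bet nu T := by
  rw [HS_col_iff] at h
  obtain ⟨hle, hge, h3⟩ := h
  have hsk := mem_skew_col alp bet hb
  set b := bet.colLen 0 with hbdef
  set l := alp.colLen 0 with hldef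
  have hpos : ∀ k, 0 < alp.rowLen k ↔ k < l := by
    intro k
    rw [← mem_iff_lt_rowLen, mem_iff_lt_colLen]
  obtain ⟨c, hc1, hc2, hc3⟩ := exists_enum (fun k => k < l ∧ nu.rowLen k = alp.rowLen k) l b
    (fun k hk => hk.1) (by
      have hs1 := card_eq_sum alp l le_rfl
      have hs2 := card_eq_sum nu l (by
        by_contra hcon
        have h4 : (l, 0) ∈ nu := mem_iff_lt_colLen.2 (by omega)
        rw [mem_iff_lt_rowLen] at h4
        have h5 := (hpos l).1 (by have := hle l; omega)
        omega)
      have hs3 : ((Finset.range l).filter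
          (fun k => k < l ∧ nu.rowLen k = alp.rowLen k)).card =
          ∑ k ∈ Finset.range l, if nu.rowLen k = alp.rowLen k then 1 else 0 := by
        rw [← Finset.card_filter]
        congr 1
        ext k
        simp only [Finset.mem_filter, Finset.mem_range]
        tauto
      have hs4 : (∑ k ∈ Finset.range l, if nu.rowLen k = alp.rowLen k then 1 else 0) +
          ∑ i ∈ Finset.range l, alp.rowLen i = (∑ i ∈ Finset.range l, nu.rowLen i) + l := by
        have : l = ∑ i ∈ Finset.range l, 1 := by simp
        nth_rewrite 4 [this]
        rw [← Finset.sum_add_distrib, ← Finset.sum_add_distrib]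
        refine Finset.sum_congr rfl fun k _ => ?_
        have := hle k
        have := hge k
        split_ifs <;> omega
      have hs5 : ((Finset.range l).filter
          (fun k => k < l ∧ nu.rowLen k = alp.rowLen k)).card + b = l := by
        rw [hs3]
        omega
      convert hs5)
  let T : ℕ × ℕ → ℕ := fun p =>
    if p ∈ skewCells alp bet then (if p.2 = 0 then c p.1 + 1 else p.1 + 1) else 0
  have hTin : ∀ i j, (i, j) ∈ skewCells alp bet → T (i, j) = if j = 0 then c i + 1 else i + 1 := by
    intro i j hij
    simp only [T]
    rw [if_pos hij]
  have hTout : ∀ p, p ∉ skewCells alp bet → T p = 0 := by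
    intro p hp
    simp only [T]
    rw [if_neg hp]
  have hT : ∀ i j k, ((i, j) ∈ skewCells alp bet ∧ T (i, j) = k + 1) ↔
      ((i = k ∧ 1 ≤ j ∧ j < alp.rowLen k) ∨ (j = 0 ∧ b ≤ i ∧ i < l ∧ c i = k)) := by
    intro i j k
    constructor
    · rintro ⟨hij, hv⟩
      rw [hTin i j hij] at hv
      rw [hsk] at hij
      split_ifs at hv with hj
      · right
        have := (hpos i).1 (by omega)
        exact ⟨hj, hij.2 hj, this, by omega⟩
      · left
        have : i = k := by omega
        subst this
        exact ⟨rfl, by omega, hij.1⟩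
    · rintro (⟨rfl, h4, h5⟩ | ⟨rfl, h4, h5, h6⟩)
      · have hij : (i, j) ∈ skewCells alp bet := (hsk i j).2 ⟨h5, by omega⟩
        refine ⟨hij, ?_⟩
        rw [hTin i j hij, if_neg (by omega)]
      · have hij : (i, 0) ∈ skewCells alp bet := (hsk _ _).2 ⟨(hpos i).2 h5, fun _ => h4⟩
        refine ⟨hij, ?_⟩
        rw [hTin _ _ hij, if_pos rfl, h6]
  refine ⟨T, ⟨?_, ?_, ?_⟩, ?_, ?_⟩
  · rintro ⟨i, j⟩
    constructor
    · intro hij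
      rw [hTin i j hij]
      split_ifs <;> omega
    · intro hne
      by_contra hn
      exact hne (hTout _ hn)
  · intro i j1 j2 hj1 hj2 hle'
    rw [hTin i j1 hj1, hTin i j2 hj2]
    rw [hsk] at hj1
    split_ifs with c1 c2 c2
    · omega
    · have := (hc1 i (hj1.2 c1) ((hpos i).1 (by omega))).2
      omega
    · omega
    · omega
  · intro i1 i2 j hi1 hi2 hlt
    rw [hTin i1 j hi1, hTin i2 j hi2]
    rw [hsk] at hi1 hi2
    split_ifs with c1
    · have := hc2 i1 i2 (hi1.2 c1) hlt ((hpos i2).1 (by omega))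
      omega
    · omega
  · intro i j k
    unfold prefixCount
    have hanti : alp.rowLen (k + 1) ≤ alp.rowLen k := alp.rowLen_anti k (k + 1) (by omega)
    have hanti' : nu.rowLen (k + 1) ≤ nu.rowLen k := nu.rowLen_anti k (k + 1) (by omega)
    by_cases hex : ∃ i0, b ≤ i0 ∧ i0 < l ∧ c i0 = k
    · obtain ⟨i0, hi0, hi0l, hi0c⟩ := hex
      refine Finset.card_le_card_of_injOn
        (fun p => if p.2 = 0 then (i0, 0) else (k, p.2)) ?_ ?_
      · rintro ⟨i', j'⟩ hp
        obtain ⟨hp1, hp2, hp3⟩ := Finset.mem_filter.1 (Finset.mem_coe.1 hp)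
        have hp4 := (hT i' j' (k + 1)).1 ⟨hp1, hp3⟩
        refine Finset.mem_coe.2 (Finset.mem_filter.2 ?_)
        simp only at hp2
        rcases hp4 with ⟨rfl, h4, h5⟩ | ⟨rfl, h4, h5, h6⟩
        · have hne : ¬ (j' = 0) := by omega
          simp only [hne, if_false]
          have h6 := (hT k j' k).2 (Or.inl ⟨rfl, by omega, by omega⟩)
          exact ⟨h6.1, by omega, h6.2⟩
        · simp only [if_true]
          have h7 := (hT i0 0 k).2 (Or.inr ⟨rfl, hi0, hi0l, hi0c⟩)
          have h8 : i0 < i' := by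
            by_contra hcon
            rcases Nat.lt_or_ge i' i0 with h9 | h9
            · have := hc2 i' i0 h4 h9 hi0l; omega
            · have : i' = i0 := by omega
              subst this; omega
          exact ⟨h7.1, by omega, h7.2⟩
      · rintro ⟨i', j'⟩ hp ⟨i'', j''⟩ hp' heq
        obtain ⟨hp1, hp2, hp3⟩ := Finset.mem_filter.1 (Finset.mem_coe.1 hp)
        have hp4 := (hT i' j' (k + 1)).1 ⟨hp1, hp3⟩
        obtain ⟨hp1', hp2', hp3'⟩ := Finset.mem_filter.1 (Finset.mem_coe.1 hp')
        have hp4' := (hT i'' j'' (k + 1)).1 ⟨hp1', hp3'⟩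
        simp only at heq
        simp only [Prod.mk.injEq]
        split_ifs at heq with c1 c2 c2 <;> simp only [Prod.mk.injEq] at heq
        · refine ⟨?_, by omega⟩
          rcases lt_trichotomy i' i'' with h9 | h9 | h9
          · have := hc2 i' i'' (by omega) h9 (by omega); omega
          · exact h9
          · have := hc2 i'' i' (by omega) h9 (by omega); omega
        · omega
        · omega
        · omega
    · have hkey : ∀ i', b ≤ i' → i' < l → c i' = k + 1 →
          k + 1 ≤ i' ∧ 1 ≤ alp.rowLen (k + 1) ∧ alp.rowLen (k + 1) + 1 ≤ alp.rowLen k := by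
        intro i' h4 h5 h6
        obtain ⟨⟨h7, h8⟩, h9⟩ := hc1 i' h4 h5
        rw [h6] at h7 h8 h9
        have h10 := (hpos (k + 1)).2 h7
        have h11 : nu.rowLen k ≠ alp.rowLen k := fun he => hex (hc3 k ⟨by omega, he⟩)
        have := hle k
        omega
      refine Finset.card_le_card_of_injOn
        (fun p => if p.2 = 0 then (k, alp.rowLen k - 1) else (k, p.2)) ?_ ?_
      · rintro ⟨i', j'⟩ hp
        obtain ⟨hp1, hp2, hp3⟩ := Finset.mem_filter.1 (Finset.mem_coe.1 hp)
        have hp4 := (hT i' j' (k + 1)).1 ⟨hp1, hp3⟩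
        refine Finset.mem_coe.2 (Finset.mem_filter.2 ?_)
        simp only at hp2
        rcases hp4 with ⟨rfl, h4, h5⟩ | ⟨rfl, h4, h5, h6⟩
        · have hne : ¬ (j' = 0) := by omega
          simp only [hne, if_false]
          have h6 := (hT k j' k).2 (Or.inl ⟨rfl, by omega, by omega⟩)
          exact ⟨h6.1, by omega, h6.2⟩
        · simp only [if_true]
          have h8 := hkey i' h4 h5 h6
          have h7 := (hT k (alp.rowLen k - 1) k).2 (Or.inl ⟨rfl, by omega, by omega⟩)
          exact ⟨h7.1, by omega, h7.2⟩
      · rintro ⟨i', j'⟩ hp ⟨i'', j''⟩ hp' heq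
        obtain ⟨hp1, hp2, hp3⟩ := Finset.mem_filter.1 (Finset.mem_coe.1 hp)
        have hp4 := (hT i' j' (k + 1)).1 ⟨hp1, hp3⟩
        obtain ⟨hp1', hp2', hp3'⟩ := Finset.mem_filter.1 (Finset.mem_coe.1 hp')
        have hp4' := (hT i'' j'' (k + 1)).1 ⟨hp1', hp3'⟩
        simp only at heq
        simp only [Prod.mk.injEq]
        split_ifs at heq with c1 c2 c2 <;> simp only [Prod.mk.injEq] at heq
        · refine ⟨?_, by omega⟩
          rcases lt_trichotomy i' i'' with h9 | h9 | h9
          · have := hc2 i' i'' (by omega) h9 (by omega); omega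
          · exact h9
          · have := hc2 i'' i' (by omega) h9 (by omega); omega
        · have := hkey i' (by omega) (by omega) (by omega); omega
        · have := hkey i'' (by omega) (by omega) (by omega); omega
        · omega
  · intro k
    unfold content
    have hc0 : ((Finset.Ico 1 (alp.rowLen k)).image (fun j => (k, j))).card = alp.rowLen k - 1 := by
      rw [Finset.card_image_of_injective, Nat.card_Ico]
      intro x y hxy; exact (Prod.mk.inj hxy).2
    by_cases hex : ∃ i0, b ≤ i0 ∧ i0 < l ∧ c i0 = k
    · obtain ⟨i0, hi0, hi0l, hi0c⟩ := hex
      have hset : ((skewCells alp bet).filter fun p => T p = k + 1) =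
          (Finset.Ico 1 (alp.rowLen k)).image (fun j => (k, j)) ∪ {(i0, 0)} := by
        ext ⟨i, j⟩
        rw [Finset.mem_filter, hT i j k, Finset.mem_union]
        simp only [Finset.mem_image, Finset.mem_Ico, Prod.mk.injEq,
          exists_eq_right_right, Finset.mem_singleton]
        constructor
        · rintro (⟨rfl, h4⟩ | ⟨rfl, h4, h5, h6⟩)
          · left; exact ⟨h4, rfl⟩
          · right
            refine ⟨?_, rfl⟩
            rcases lt_trichotomy i i0 with h9 | h9 | h9
            · have := hc2 i i0 (by omega) h9 (by omega); omega
            · exact h9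
            · have := hc2 i0 i (by omega) h9 (by omega); omega
        · rintro (⟨h4, rfl⟩ | ⟨rfl, rfl⟩)
          · left; exact ⟨rfl, h4⟩
          · right; exact ⟨rfl, hi0, hi0l, hi0c⟩
      rw [hset, Finset.card_union_of_disjoint, hc0, Finset.card_singleton]
      · obtain ⟨⟨h7, h8⟩, h9⟩ := hc1 i0 hi0 hi0l
        rw [hi0c] at h7 h8
        have := (hpos k).2 h7
        omega
      · rw [Finset.disjoint_singleton_right]
        intro hp
        simp only [Finset.mem_image, Finset.mem_Ico, Prod.mk.injEq] at hp
        obtain ⟨_, _, h4, _⟩ := hp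
        omega
    · have hset : ((skewCells alp bet).filter fun p => T p = k + 1) =
          (Finset.Ico 1 (alp.rowLen k)).image (fun j => (k, j)) := by
        ext ⟨i, j⟩
        rw [Finset.mem_filter, hT i j k]
        simp only [Finset.mem_image, Finset.mem_Ico, Prod.mk.injEq,
          exists_eq_right_right]
        constructor
        · rintro (⟨rfl, h4⟩ | ⟨rfl, h4⟩)
          · exact ⟨h4, rfl⟩
          · exact absurd ⟨i, h4⟩ hex
        · rintro ⟨h4, rfl⟩
          left; exact ⟨rfl, h4⟩
      rw [hset, hc0]
      have h4 := hle k
      have h5 := hge k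
      have h6 := hpos k
      by_cases hk : k < l
      · have h11 : nu.rowLen k ≠ alp.rowLen k := fun he => hex (hc3 k ⟨hk, he⟩)
        omega
      · omega

/-- if `mu` is a single row with more than one box, `bet` is a single column
with more than one box, both outer shapes have at least 4 distinct part sizes and the skew
Schur functions agree, then `lam = alp` is a staircase partition and `alp/bet` is the
conjugate of `lam/mu`. -/
theorem staircase_conjugate_case (lam mu alp bet : YoungDiagram)
    (hmu : mu ≤ lam) (hbet : bet ≤ alp)
    (hm : mu.colLen 0 = 1) (hmu1 : 1 < mu.rowLen 0)
    (hb1 : bet.rowLen 0 = 1) (hbcol : 1 < bet.colLen 0)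
    (hdplam : 4 ≤ dp lam) (hdpalp : 4 ≤ dp alp)
    (hbasic1 : IsBasic lam mu) (hconn1 : IsConnectedSkew lam mu)
    (hbasic2 : IsBasic alp bet) (hconn2 : IsConnectedSkew alp bet)
    (h : SchurEq lam mu alp bet) :
    (∃ n, lam = staircase n) ∧ alp = lam ∧ bet = mu.transpose := by
  have hE : ∀ nu, HS lam (mu.rowLen 0) nu ↔ HS alp.transpose (bet.colLen 0) nu.transpose := by
    intro nu
    have h1 : (∃ T, IsLR lam mu nu T) ↔ (∃ T, IsLR alp bet nu T) := by
      rw [← lrCoeff_ne_zero lam mu nu hmu, ← lrCoeff_ne_zero alp bet nu hbet, h nu]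
    constructor
    · intro h2
      obtain ⟨T, hT⟩ := h1.1 (row_suf lam mu nu hm h2)
      exact col_nec alp bet nu T hbet hb1 hT
    · intro h2
      obtain ⟨T, hT⟩ := h1.2 (col_suf alp bet nu hb1 h2)
      exact row_nec lam mu nu T hmu hm hT
  have hs : mu.rowLen 0 < lam.rowLen 1 := by
    refine hconn1 0 ?_
    have h1 := dp_col lam hdplam 0
    have h2 := dp_row lam hdplam 0
    by_contra hcon
    have h3 := Finset.card_image_le (s := Finset.range (lam.colLen 0)) (f := fun i => lam.rowLen i)
    rw [Finset.card_range] at h3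
    unfold dp at hdplam
    omega
  have hbl : bet.colLen 0 < alp.colLen 0 := by
    refine hbasic2.2 0 ?_
    have h1 := dp_row alp hdpalp 0
    have := alp.rowLen_anti 0 1 (by omega)
    simp only [zero_add] at h1
    by_contra hcon
    omega
  have ht : bet.colLen 0 < alp.transpose.rowLen 1 := by
    rw [rowLen_transpose, ← mem_iff_lt_colLen, mem_iff_lt_rowLen]
    have h1 := hconn2 (bet.colLen 0 - 1) (by omega)
    rw [rowLen_of_col bet hb1, if_pos (by omega)] at h1
    have h2 : bet.colLen 0 - 1 + 1 = bet.colLen 0 := by omega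
    rwa [h2] at h1
  obtain ⟨h1, h2, h3, h4⟩ := core lam alp.transpose (mu.rowLen 0) (bet.colLen 0) hmu1 hs hbcol ht
    (dp_row lam hdplam) (by
      intro i
      simp only [rowLen_transpose]
      exact dp_col alp hdpalp i) hE
  rw [transpose_transpose] at h1
  refine ⟨⟨lam.rowLen 0, eq_staircase lam h2 ?_⟩, h1.symm, ?_⟩
  · intro i
    have := h3 i
    simp only [rowLen_transpose] at this
    rw [h1]
    exact this
  · ext ⟨i, j⟩
    rw [mem_cells, mem_cells, mem_transpose, mem_iff_lt_rowLen, rowLen_of_col bet hb1, ← h4]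
    have h5 : (i, j).swap ∈ mu ↔ i < mu.rowLen j := mem_iff_lt_rowLen
    rw [h5]
    rcases Nat.eq_zero_or_pos j with rfl | hj
    · split_ifs <;> omega
    · rw [rowLen_of_row mu hm j hj]
      split_ifs <;> omega

end LRSkew
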